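/- W*AP(ℝ^d) is a closed subspace of BUC(ℝ^d): if (f_n) is a sequence of functions each of the form f_n = g_n + h_n with g_n ∈ AP(ℝ^d) and h_n ∈ N(ℝ^d), f : ℝ^d → ℝ is bounded uniformly continuous, and ‖f_n − f‖∞ → 0 as n → ∞, then there exist g ∈ AP(ℝ^d) and h ∈ N(ℝ^d) with f = g + h. -/

import Mathlib

open MeasureTheory Filter Topology

/-- The translate of a bounded continuous function `f` by `l`: the function `x ↦ f (x + l)`. -/
noncomputable def translateBCF {d : ℕ}
    (f : BoundedContinuousFunction (EuclideanSpace ℝ (Fin d)) ℝ)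
    (l : EuclideanSpace ℝ (Fin d)) :
    BoundedContinuousFunction (EuclideanSpace ℝ (Fin d)) ℝ :=
  f.compContinuous ⟨fun x => x + l, by continuity⟩

/-- `f` is almost periodic in the Bochner sense: `f` is (bounded and) uniformly continuous and
its set of translates is totally bounded in the sup norm. -/
def IsAP {d : ℕ} (f : BoundedContinuousFunction (EuclideanSpace ℝ (Fin d)) ℝ) : Prop :=
  UniformContinuous ⇑f ∧
  TotallyBounded {g : BoundedContinuousFunction (EuclideanSpace ℝ (Fin d)) ℝ |
    ∃ l : EuclideanSpace ℝ (Fin d), g = translateBCF f l}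

/-- `f` belongs to `N(ℝ^d)`: it is (bounded and) uniformly continuous and the averages of `|f|`
over balls `B(0,R)` tend to `0` as `R → ∞`. -/
def IsVanishingMean {d : ℕ} (f : BoundedContinuousFunction (EuclideanSpace ℝ (Fin d)) ℝ) : Prop :=
  UniformContinuous ⇑f ∧
  Tendsto (fun R : ℝ =>
    ⨍ y in Metric.ball (0 : EuclideanSpace ℝ (Fin d)) R, |f y|) atTop (𝓝 0)

open scoped BoundedContinuousFunction

@[simp]
lemma translateBCF_apply {d : ℕ} (f : EuclideanSpace ℝ (Fin d) →ᵇ ℝ)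
    (l x : EuclideanSpace ℝ (Fin d)) : translateBCF f l x = f (x + l) := rfl

lemma Continuous.integrableOn_ball {E : Type*} [MetricSpace E] [ProperSpace E]
    [MeasurableSpace E] [BorelSpace E] {μ : Measure E} [IsLocallyFiniteMeasure μ]
    {φ : E → ℝ} (hφ : Continuous φ) (x : E) (R : ℝ) : IntegrableOn φ (Metric.ball x R) μ :=
  (hφ.continuousOn.integrableOn_compact (isCompact_closedBall x R)).mono_set
    Metric.ball_subset_closedBall

lemma setAverage_nonneg {α : Type*} [MeasurableSpace α] {μ : Measure α} {φ : α → ℝ}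
    (h : ∀ x, 0 ≤ φ x) (s : Set α) : 0 ≤ ⨍ y in s, φ y ∂μ := by
  rw [setAverage_eq, smul_eq_mul]
  exact mul_nonneg (by positivity) (integral_nonneg h)

lemma ballAverage_const {E : Type*} [PseudoMetricSpace E] [ProperSpace E] [MeasurableSpace E]
    {μ : Measure E} [IsFiniteMeasureOnCompacts μ] [μ.IsOpenPosMeasure] {R : ℝ} (hR : 0 < R)
    (x : E) (c : ℝ) : ⨍ _ in Metric.ball x R, c ∂μ = c :=
  setAverage_const (Metric.measure_ball_pos μ x hR).ne' measure_ball_lt_top.ne c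

section BallAverage

variable {E : Type*} [NormedAddCommGroup E] [NormedSpace ℝ E] [FiniteDimensional ℝ E]
  [MeasurableSpace E] [BorelSpace E] {μ : Measure E} [μ.IsAddHaarMeasure]

lemma ballAverage_mono {φ ψ : E → ℝ} (hφ : Continuous φ) (hψ : Continuous ψ)
    (h : ∀ x, φ x ≤ ψ x) (x : E) (R : ℝ) :
    ⨍ y in Metric.ball x R, φ y ∂μ ≤ ⨍ y in Metric.ball x R, ψ y ∂μ := by
  have := FiniteDimensional.proper_real E
  rw [setAverage_eq, setAverage_eq, smul_eq_mul, smul_eq_mul]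
  exact mul_le_mul_of_nonneg_left
    (setIntegral_mono (hφ.integrableOn_ball x R) (hψ.integrableOn_ball x R) h) (by positivity)

lemma ballAverage_add {φ ψ : E → ℝ} (hφ : Continuous φ) (hψ : Continuous ψ) (x : E) (R : ℝ) :
    ⨍ y in Metric.ball x R, (φ y + ψ y) ∂μ =
      (⨍ y in Metric.ball x R, φ y ∂μ) + ⨍ y in Metric.ball x R, ψ y ∂μ := by
  have := FiniteDimensional.proper_real E
  simp only [setAverage_eq]
  rw [integral_add (hφ.integrableOn_ball x R) (hψ.integrableOn_ball x R), smul_add]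

lemma ballAverage_finsetSum {ι : Type*} (s : Finset ι) {φ : ι → E → ℝ}
    (hφ : ∀ i, Continuous (φ i)) (x : E) (R : ℝ) :
    ⨍ y in Metric.ball x R, (∑ i ∈ s, φ i y) ∂μ = ∑ i ∈ s, ⨍ y in Metric.ball x R, φ i y ∂μ := by
  have := FiniteDimensional.proper_real E
  simp only [setAverage_eq]
  rw [integral_finsetSum _ fun i _ => (hφ i).integrableOn_ball x R, Finset.smul_sum]

/-- Averages over a ball of a translate are controlled by averages over the doubled ball. -/
lemma ballAverage_translate_le {φ : E → ℝ} (hφ : Continuous φ) (h : ∀ x, 0 ≤ φ x) (k : E)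
    {R : ℝ} (hk : ‖k‖ ≤ R) :
    ⨍ y in Metric.ball (0 : E) R, φ (y + k) ∂μ ≤
      2 ^ Module.finrank ℝ E * ⨍ y in Metric.ball (0 : E) (2 * R), φ y ∂μ := by
  have := FiniteDimensional.proper_real E
  have hvol : μ.real (Metric.ball (0 : E) (2 * R)) =
      2 ^ Module.finrank ℝ E * μ.real (Metric.ball (0 : E) R) := by
    rw [Measure.real, Measure.addHaar_ball_mul_of_pos μ 0 two_pos, ENNReal.toReal_mul,
      ENNReal.toReal_ofReal (by positivity), Measure.real]
  have hle_int : ∫ y in Metric.ball (0 : E) R, φ (y + k) ∂μ ≤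
      ∫ y in Metric.ball (0 : E) (2 * R), φ y ∂μ := by
    have hsub : Metric.ball (0 : E) R ⊆ (· + k) ⁻¹' Metric.ball (0 : E) (2 * R) := by
      intro y hy
      simp only [Set.mem_preimage, mem_ball_zero_iff] at hy ⊢
      linarith [norm_add_le y k]
    rw [← (measurePreserving_add_right μ k).setIntegral_preimage_emb
      (measurableEmbedding_addRight k) φ (Metric.ball 0 (2 * R))]
    refine setIntegral_mono_set ?_ (ae_of_all _ fun y => h _) hsub.eventuallyLE
    exact ((measurePreserving_add_right μ k).integrableOn_comp_preimage
      (measurableEmbedding_addRight k)).2 (hφ.integrableOn_ball 0 (2 * R))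
  rw [setAverage_eq, setAverage_eq, smul_eq_mul, smul_eq_mul, hvol, mul_inv, ← mul_assoc,
    mul_inv_cancel_left₀ (by positivity)]
  exact mul_le_mul_of_nonneg_left hle_int (by positivity)

end BallAverage

section VanishingMean

variable {d : ℕ}

lemma IsVanishingMean.sub {f g : EuclideanSpace ℝ (Fin d) →ᵇ ℝ} (hf : IsVanishingMean f)
    (hg : IsVanishingMean g) : IsVanishingMean (f - g) := by
  refine ⟨hf.1.sub hg.1, squeeze_zero (fun R => setAverage_nonneg (fun _ => abs_nonneg _) _)
    (fun R => ?_) (by simpa using hf.2.add hg.2)⟩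
  rw [← ballAverage_add f.continuous.abs g.continuous.abs]
  exact ballAverage_mono (f - g).continuous.abs (f.continuous.abs.add g.continuous.abs)
    (fun x => abs_sub _ _) 0 R

lemma IsVanishingMean.tendsto_translate {h : EuclideanSpace ℝ (Fin d) →ᵇ ℝ}
    (hh : IsVanishingMean h) (k : EuclideanSpace ℝ (Fin d)) :
    Tendsto (fun R : ℝ => ⨍ y in Metric.ball (0 : EuclideanSpace ℝ (Fin d)) R, |h (y + k)|)
      atTop (𝓝 0) := by
  have hlim := (hh.2.comp (tendsto_id.const_mul_atTop (two_pos : (0 : ℝ) < 2))).const_mul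
    (2 ^ Module.finrank ℝ (EuclideanSpace ℝ (Fin d)))
  rw [mul_zero] at hlim
  refine squeeze_zero' (Eventually.of_forall
    fun R => setAverage_nonneg (fun _ => abs_nonneg _) _) ?_ hlim
  filter_upwards [eventually_ge_atTop ‖k‖] with R hk
  exact ballAverage_translate_le h.continuous.abs (fun _ => abs_nonneg _) k hk

lemma isVanishingMean_of_approx {h : EuclideanSpace ℝ (Fin d) →ᵇ ℝ} (hUC : UniformContinuous h)
    (happ : ∀ ε > 0, ∃ u, IsVanishingMean u ∧ ‖h - u‖ < ε) : IsVanishingMean h := by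
  refine ⟨hUC, tendsto_order.2 ⟨fun a ha => Eventually.of_forall fun R =>
    ha.trans_le (setAverage_nonneg (fun _ => abs_nonneg _) _), fun ε hε => ?_⟩⟩
  obtain ⟨u, hu, hhu⟩ := happ (ε / 2) (half_pos hε)
  filter_upwards [hu.2.eventually_lt_const (half_pos hε), eventually_gt_atTop 0] with R hR hR0
  have hle := ballAverage_mono (μ := volume) h.continuous.abs
    (u.continuous.abs.add continuous_const) (ψ := fun x => |u x| + ‖h - u‖)
    (fun x => by
      have hx := (h - u).norm_coe_le_norm x
      rw [BoundedContinuousFunction.sub_apply, Real.norm_eq_abs] at hx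
      linarith [abs_sub_abs_le_abs_sub (h x) (u x)]) 0 R
  rw [ballAverage_add u.continuous.abs continuous_const, ballAverage_const hR0] at hle
  linarith

end VanishingMean

section AlmostPeriodic

variable {d : ℕ}

lemma dist_translateBCF_le (f g : EuclideanSpace ℝ (Fin d) →ᵇ ℝ)
    (l : EuclideanSpace ℝ (Fin d)) :
    dist (translateBCF f l) (translateBCF g l) ≤ dist f g :=
  (BoundedContinuousFunction.dist_le dist_nonneg).2 fun x => f.dist_coe_le_dist (x + l)

lemma isAP_iff {f : EuclideanSpace ℝ (Fin d) →ᵇ ℝ} :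
    IsAP f ↔ UniformContinuous f ∧ ∀ ε > 0, ∃ t : Finset (EuclideanSpace ℝ (Fin d)),
      ∀ l, ∃ k ∈ t, dist (translateBCF f l) (translateBCF f k) < ε := by
  classical
  refine and_congr_right fun _ => ⟨fun h ε hε => ?_, fun h => Metric.totallyBounded_iff.2
    fun ε hε => ?_⟩
  · obtain ⟨s, hs, hfin, hcov⟩ := Metric.finite_approx_of_totallyBounded h ε hε
    have hs' : ∀ u ∈ s, ∃ k, u = translateBCF f k := fun u hu => hs hu
    choose! k hk using hs'
    refine ⟨hfin.toFinset.image k, fun l => ?_⟩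
    obtain ⟨u, hu, hlu⟩ := Set.mem_iUnion₂.1 (hcov ⟨l, rfl⟩)
    refine ⟨k u, Finset.mem_image_of_mem _ (hfin.mem_toFinset.2 hu), ?_⟩
    rwa [← hk u hu]
  · obtain ⟨t, ht⟩ := h ε hε
    refine ⟨translateBCF f '' t, t.finite_toSet.image _, ?_⟩
    rintro _ ⟨l, rfl⟩
    obtain ⟨k, hk, hlk⟩ := ht l
    exact Set.mem_iUnion₂.2 ⟨_, Set.mem_image_of_mem _ hk, hlk⟩

lemma IsAP.sub {f g : EuclideanSpace ℝ (Fin d) →ᵇ ℝ} (hf : IsAP f) (hg : IsAP g) :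
    IsAP (f - g) := by
  refine ⟨hf.1.sub hg.1, TotallyBounded.subset ?_
    ((hf.2.closure.isCompact_of_isClosed isClosed_closure).prod
      (hg.2.closure.isCompact_of_isClosed isClosed_closure) |>.image continuous_sub).totallyBounded⟩
  rintro _ ⟨l, rfl⟩
  exact ⟨(translateBCF f l, translateBCF g l),
    ⟨subset_closure ⟨l, rfl⟩, subset_closure ⟨l, rfl⟩⟩, rfl⟩

lemma isAP_of_tendsto {g : ℕ → EuclideanSpace ℝ (Fin d) →ᵇ ℝ} {f : EuclideanSpace ℝ (Fin d) →ᵇ ℝ}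
    (hg : ∀ n, IsAP (g n)) (hlim : Tendsto g atTop (𝓝 f)) : IsAP f := by
  refine isAP_iff.2 ⟨(BoundedContinuousFunction.tendsto_iff_tendstoUniformly.1
    hlim).uniformContinuous (Frequently.of_forall fun n => (hg n).1), fun ε hε => ?_⟩
  obtain ⟨n, hn⟩ := (Metric.tendsto_nhds.1 hlim (ε / 3) (by positivity)).exists
  obtain ⟨t, ht⟩ := (isAP_iff.1 (hg n)).2 (ε / 3) (by positivity)
  refine ⟨t, fun l => ?_⟩
  obtain ⟨k, hk, hlk⟩ := ht l
  refine ⟨k, hk, ?_⟩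
  have h4 := dist_triangle4 (translateBCF f l) (translateBCF (g n) l) (translateBCF (g n) k)
    (translateBCF f k)
  linarith [dist_translateBCF_le f (g n) l, dist_translateBCF_le (g n) f k, dist_comm f (g n)]

/-- Adding a function of vanishing mean cannot decrease the sup norm of an almost periodic one. -/
lemma IsAP.norm_le_norm_add {g h : EuclideanSpace ℝ (Fin d) →ᵇ ℝ} (hg : IsAP g)
    (hh : IsVanishingMean h) : ‖g‖ ≤ ‖g + h‖ := by
  refine (BoundedContinuousFunction.norm_le (norm_nonneg _)).2 fun x => ?_
  refine le_of_forall_pos_le_add fun ε hε => ?_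
  by_contra! hlt
  obtain ⟨t, ht⟩ := (isAP_iff.1 hg).2 (ε / 2) (half_pos hε)
  have hsum : ∀ l, ε / 2 ≤ ∑ k ∈ t, |h (l + (x - k))| := by
    intro l
    obtain ⟨k, hk, hlk⟩ := ht l
    refine le_trans ?_ (Finset.single_le_sum (f := fun k => |h (l + (x - k))|)
      (fun _ _ => abs_nonneg _) hk)
    have hd := (BoundedContinuousFunction.dist_coe_le_dist (x - k)).trans_lt hlk
    rw [translateBCF_apply, translateBCF_apply, sub_add_cancel, add_comm, Real.dist_eq,
      abs_sub_comm] at hd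
    have hn := (g + h).norm_coe_le_norm (l + (x - k))
    rw [BoundedContinuousFunction.add_apply, Real.norm_eq_abs] at hn
    rw [Real.norm_eq_abs] at hlt
    have h1 := abs_sub_abs_le_abs_sub (g x) (g (l + (x - k)))
    have h2 := abs_sub (g (l + (x - k)) + h (l + (x - k))) (h (l + (x - k)))
    rw [add_sub_cancel_right] at h2
    linarith
  have hcont : ∀ k, Continuous fun y => |h (y + (x - k))| := fun k => by fun_prop
  have hlim := tendsto_finsetSum t fun k _ => hh.tendsto_translate (x - k)
  rw [Finset.sum_const_zero] at hlim
  obtain ⟨R, hR, hR0⟩ := ((hlim.eventually_lt_const (half_pos hε)).and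
    (eventually_gt_atTop 0)).exists
  have hle := ballAverage_mono (μ := volume) continuous_const
    (continuous_finsetSum t fun k _ => hcont k) hsum 0 R
  rw [ballAverage_const hR0, ballAverage_finsetSum t hcont] at hle
  linarith

end AlmostPeriodic

/-- `W*AP(ℝ^d) := AP(ℝ^d) + N(ℝ^d)` is a closed subspace of `BUC(ℝ^d)`: a sup-norm limit of
functions of the form `gₙ + hₙ`, with `gₙ ∈ AP(ℝ^d)` and `hₙ ∈ N(ℝ^d)`, is of the same form. -/
theorem wstarap_closed {d : ℕ}
    (gn hn : ℕ → BoundedContinuousFunction (EuclideanSpace ℝ (Fin d)) ℝ)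
    (f : BoundedContinuousFunction (EuclideanSpace ℝ (Fin d)) ℝ)
    (hgn : ∀ n, IsAP (gn n)) (hhn : ∀ n, IsVanishingMean (hn n))
    (hUC : UniformContinuous ⇑f)
    (hconv : Tendsto (fun n => ‖gn n + hn n - f‖) atTop (𝓝 0)) :
    ∃ g h : BoundedContinuousFunction (EuclideanSpace ℝ (Fin d)) ℝ,
      IsAP g ∧ IsVanishingMean h ∧ f = g + h := by
  have hlim := tendsto_iff_norm_sub_tendsto_zero.2 hconv
  have hcauchy : CauchySeq gn := by
    refine Metric.cauchySeq_iff.2 fun ε hε => ?_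
    obtain ⟨N, hN⟩ := Metric.cauchySeq_iff.1 hlim.cauchySeq ε hε
    refine ⟨N, fun m hm n hn' => lt_of_le_of_lt ?_ (hN m hm n hn')⟩
    rw [dist_eq_norm, dist_eq_norm, add_sub_add_comm]
    exact ((hgn m).sub (hgn n)).norm_le_norm_add ((hhn m).sub (hhn n))
  obtain ⟨g, hg⟩ := cauchySeq_tendsto_of_complete hcauchy
  have hAP := isAP_of_tendsto hgn hg
  have hh : Tendsto hn atTop (𝓝 (f - g)) := by simpa using hlim.sub hg
  refine ⟨g, f - g, hAP, isVanishingMean_of_approx (hUC.sub hAP.1) fun ε hε => ?_,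
    (add_sub_cancel g f).symm⟩
  obtain ⟨n, hn'⟩ := (Metric.tendsto_nhds.1 hh ε hε).exists
  exact ⟨hn n, hhn n, by rwa [← dist_eq_norm, dist_comm]⟩
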